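/- arXiv:2111.15233 — 4 statements merged into one kernel-verified Lean document; each statement's English description precedes it below -/
import Mathlib

section
/- Let θ_td and φ_td be as defined in the context. Then Var_p(φ_td) = Σ_{z,c} (p(z|a⋆,c) − p(z|a°,c))²·Σ_ā p(ā,c)·var(Y|ā,z,c)/p(z|ā,c) + Σ_{z,c} p(z|a⋆,c)·(Σ_ā E(Y|ā,z,c)·p(ā|c))²·p(c)/p(a⋆|c) + Σ_{z,c} p(z|a°,c)·(Σ_ā E(Y|ā,z,c)·p(ā|c))²·p(c)/p(a°|c) − Σ_c ((Σ_{ā,z} E(Y|ā,z,c)·p(z|a⋆,c)·p(ā|c))²/p(a⋆|c) + (Σ_{ā,z} E(Y|ā,z,c)·p(z|a°,c)·p(ā|c))²/p(a°|c))·p(c) + Σ_{ā,c} (Σ_z E(Y|ā,z,c)·(p(z|a⋆,c) − p(z|a°,c)))²·p(ā,c) − θ_td². -/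
open Finset

noncomputable section

namespace TwoDoorPaper

/-- Indicator 1[a = b] as a real number. -/
def ind {A : Type*} [DecidableEq A] (a b : A) : ℝ := if a = b then 1 else 0

variable {C A Z Y : Type*} [Fintype C] [Fintype A] [Fintype Z] [Fintype Y]

/-- Marginal p(c). -/
def pC (p : C → A → Z → Y → ℝ) (c : C) : ℝ := ∑ a, ∑ z, ∑ y, p c a z y

/-- Marginal p(a,c). -/
def pAC (p : C → A → Z → Y → ℝ) (a : A) (c : C) : ℝ := ∑ z, ∑ y, p c a z y

/-- Marginal p(c,a,z). -/
def pCAZ (p : C → A → Z → Y → ℝ) (c : C) (a : A) (z : Z) : ℝ := ∑ y, p c a z y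

/-- Marginal p(a). -/
def pA (p : C → A → Z → Y → ℝ) (a : A) : ℝ := ∑ c, pAC p a c

/-- Marginal p(a,z). -/
def pAZ (p : C → A → Z → Y → ℝ) (a : A) (z : Z) : ℝ := ∑ c, pCAZ p c a z

/-- Marginal p(z,c). -/
def pZC (p : C → A → Z → Y → ℝ) (z : Z) (c : C) : ℝ := ∑ a, pCAZ p c a z

/-- Conditional p(a|c). -/
def cA (p : C → A → Z → Y → ℝ) (a : A) (c : C) : ℝ := pAC p a c / pC p c

/-- Conditional p(z|a,c). -/
def cZ (p : C → A → Z → Y → ℝ) (z : Z) (a : A) (c : C) : ℝ := pCAZ p c a z / pAC p a c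

/-- Conditional p(z|a). -/
def cZA (p : C → A → Z → Y → ℝ) (z : Z) (a : A) : ℝ := pAZ p a z / pA p a

/-- Conditional p(y|a,z,c). -/
def cY (p : C → A → Z → Y → ℝ) (a : A) (z : Z) (c : C) (y : Y) : ℝ := p c a z y / pCAZ p c a z

/-- Conditional p(y|a,z). -/
def cYaz (p : C → A → Z → Y → ℝ) (a : A) (z : Z) (y : Y) : ℝ := (∑ c, p c a z y) / pAZ p a z

/-- Conditional p(y|a,c). -/
def cYac (p : C → A → Z → Y → ℝ) (a : A) (c : C) (y : Y) : ℝ := (∑ z, p c a z y) / pAC p a c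

/-- Conditional p(y|z,c). -/
def cYzc (p : C → A → Z → Y → ℝ) (z : Z) (c : C) (y : Y) : ℝ := (∑ a, p c a z y) / pZC p z c

/-- Conditional expectation E(Y|a,z,c). -/
def EYazc (p : C → A → Z → Y → ℝ) (yv : Y → ℝ) (a : A) (z : Z) (c : C) : ℝ :=
  ∑ y, yv y * cY p a z c y

/-- Conditional variance var(Y|a,z,c). -/
def VYazc (p : C → A → Z → Y → ℝ) (yv : Y → ℝ) (a : A) (z : Z) (c : C) : ℝ :=
  (∑ y, (yv y) ^ 2 * cY p a z c y) - (EYazc p yv a z c) ^ 2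

/-- Conditional expectation E(Y|a,z). -/
def EYaz (p : C → A → Z → Y → ℝ) (yv : Y → ℝ) (a : A) (z : Z) : ℝ :=
  ∑ y, yv y * cYaz p a z y

/-- Conditional variance var(Y|a,z). -/
def VYaz (p : C → A → Z → Y → ℝ) (yv : Y → ℝ) (a : A) (z : Z) : ℝ :=
  (∑ y, (yv y) ^ 2 * cYaz p a z y) - (EYaz p yv a z) ^ 2

/-- Conditional expectation E(Y|a,c). -/
def EYac (p : C → A → Z → Y → ℝ) (yv : Y → ℝ) (a : A) (c : C) : ℝ :=
  ∑ y, yv y * cYac p a c y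

/-- Conditional expectation E(Y|z,c). -/
def EYzc (p : C → A → Z → Y → ℝ) (yv : Y → ℝ) (z : Z) (c : C) : ℝ :=
  ∑ y, yv y * cYzc p z c y

/-- Conditional variance var(Y|z,c). -/
def VYzc (p : C → A → Z → Y → ℝ) (yv : Y → ℝ) (z : Z) (c : C) : ℝ :=
  (∑ y, (yv y) ^ 2 * cYzc p z c y) - (EYzc p yv z c) ^ 2

/-- var(C|a) for real-valued covariates. -/
def VCgivenA (p : C → A → Z → Y → ℝ) (cv : C → ℝ) (a : A) : ℝ :=
  (∑ c, (cv c) ^ 2 * (pAC p a c / pA p a)) - (∑ c, cv c * (pAC p a c / pA p a)) ^ 2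

/-- var(Z|a) for real-valued mediators. -/
def VZgivenA (p : C → A → Z → Y → ℝ) (zv : Z → ℝ) (a : A) : ℝ :=
  (∑ z, (zv z) ^ 2 * cZA p z a) - (∑ z, zv z * cZA p z a) ^ 2

/-- Expectation of f under p. -/
def Ep (p : C → A → Z → Y → ℝ) (f : C → A → Z → Y → ℝ) : ℝ :=
  ∑ c, ∑ a, ∑ z, ∑ y, p c a z y * f c a z y

/-- Variance of f under p. -/
def Varp (p : C → A → Z → Y → ℝ) (f : C → A → Z → Y → ℝ) : ℝ :=
  (∑ c, ∑ a, ∑ z, ∑ y, p c a z y * (f c a z y) ^ 2) - (Ep p f) ^ 2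

/-- p is a strictly positive probability mass function. -/
def IsPMF (p : C → A → Z → Y → ℝ) : Prop :=
  (∀ c a z y, 0 < p c a z y) ∧ (∑ c, ∑ a, ∑ z, ∑ y, p c a z y) = 1

/-- Y ⊥ A | (Z, C): p(y|a,z,c) does not depend on a. -/
def IndepYA (p : C → A → Z → Y → ℝ) : Prop :=
  ∀ a a' z c y, cY p a z c y = cY p a' z c y

/-- Z ⊥ C | A: p(z|a,c) = p(z|a) for all c. -/
def IndepZC (p : C → A → Z → Y → ℝ) : Prop :=
  ∀ z a c, cZ p z a c = cZA p z a

/-- θ_td. -/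
def thTD (p : C → A → Z → Y → ℝ) (yv : Y → ℝ) (astar acirc : A) : ℝ :=
  ∑ z, ∑ c, ∑ ab, EYazc p yv ab z c * (cZ p z astar c - cZ p z acirc c) * cA p ab c * pC p c

/-- The two-door efficient influence function φ_td. -/
def phiTD [DecidableEq A] (p : C → A → Z → Y → ℝ) (yv : Y → ℝ) (astar acirc : A)
    (c : C) (a : A) (z : Z) (y : Y) : ℝ :=
  (yv y - EYazc p yv a z c) * (cZ p z astar c - cZ p z acirc c) / cZ p z a c
  + ((∑ ab, EYazc p yv ab z c * cA p ab c)
      - ∑ ab, ∑ z', EYazc p yv ab z' c * cZ p z' a c * cA p ab c)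
    * (ind a astar - ind a acirc) / cA p a c
  + (∑ z', EYazc p yv a z' c * (cZ p z' astar c - cZ p z' acirc c))
  - thTD p yv astar acirc

/-- θ_bd. -/
def thBD (p : C → A → Z → Y → ℝ) (yv : Y → ℝ) (astar acirc : A) : ℝ :=
  ∑ c, pC p c * (EYac p yv astar c - EYac p yv acirc c)

/-- The back-door efficient influence function φ_bd. -/
def phiBD [DecidableEq A] (p : C → A → Z → Y → ℝ) (yv : Y → ℝ) (astar acirc : A)
    (c : C) (a : A) (_z : Z) (y : Y) : ℝ :=
  ind a astar * (yv y - EYac p yv astar c) / cA p astar c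
  - ind a acirc * (yv y - EYac p yv acirc c) / cA p acirc c
  + EYac p yv astar c - EYac p yv acirc c - thBD p yv astar acirc

/-- θ° (for the combined back-door/two-door model). -/
def thBDTD (p : C → A → Z → Y → ℝ) (yv : Y → ℝ) (astar acirc : A) : ℝ :=
  ∑ z, ∑ c, EYzc p yv z c * (cZ p z astar c - cZ p z acirc c) * pC p c

/-- The efficient influence function φ_bdtd. -/
def phiBDTD [DecidableEq A] (p : C → A → Z → Y → ℝ) (yv : Y → ℝ) (astar acirc : A)
    (c : C) (a : A) (z : Z) (y : Y) : ℝ :=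
  (yv y - EYzc p yv z c) * (cZ p z astar c - cZ p z acirc c) / (∑ ab, cZ p z ab c * cA p ab c)
  + (EYzc p yv z c - ∑ z', EYzc p yv z' c * cZ p z' a c)
    * (ind a astar - ind a acirc) / cA p a c
  + (∑ z', EYzc p yv z' c * (cZ p z' astar c - cZ p z' acirc c))
  - thBDTD p yv astar acirc

/-- ψ_fd(ă). -/
def psiFD (p : C → A → Z → Y → ℝ) (yv : Y → ℝ) (abreve : A) : ℝ :=
  ∑ z, ∑ ab, EYaz p yv ab z * pA p ab * cZA p z abreve

/-- θ_fd. -/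
def thFD (p : C → A → Z → Y → ℝ) (yv : Y → ℝ) (astar acirc : A) : ℝ :=
  psiFD p yv astar - psiFD p yv acirc

/-- The front-door efficient influence function φ_fd. -/
def phiFD [DecidableEq A] (p : C → A → Z → Y → ℝ) (yv : Y → ℝ) (astar acirc : A)
    (_c : C) (a : A) (z : Z) (y : Y) : ℝ :=
  (yv y - EYaz p yv a z) * (cZA p z astar - cZA p z acirc) / cZA p z a
  + ind a astar * ((∑ ab, EYaz p yv ab z * pA p ab) - psiFD p yv astar) / pA p astar
  - ind a acirc * ((∑ ab, EYaz p yv ab z * pA p ab) - psiFD p yv acirc) / pA p acirc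
  + (∑ z', EYaz p yv a z' * (cZA p z' astar - cZA p z' acirc))
  - thFD p yv astar acirc

/-- θ' (for the combined front-door/two-door model). -/
def thFDTD (p : C → A → Z → Y → ℝ) (yv : Y → ℝ) (astar acirc : A) : ℝ :=
  ∑ c, ∑ ab, ∑ z, EYazc p yv ab z c * (cZA p z astar - cZA p z acirc) * cA p ab c * pC p c

/-- The efficient influence function φ_fdtd. -/
def phiFDTD [DecidableEq A] (p : C → A → Z → Y → ℝ) (yv : Y → ℝ) (astar acirc : A)
    (c : C) (a : A) (z : Z) (y : Y) : ℝ :=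
  (yv y - EYazc p yv a z c) * (cZA p z astar - cZA p z acirc) / cZA p z a
  + (∑ c', ((∑ ab, EYazc p yv ab z c' * cA p ab c')
        - ∑ ab, ∑ z', EYazc p yv ab z' c' * cZA p z' a * cA p ab c') * pC p c')
    * (ind a astar - ind a acirc) / pA p a
  + (∑ z', EYazc p yv a z' c * (cZA p z' astar - cZA p z' acirc))
  - thFDTD p yv astar acirc

/-- θ'' (for the combined back/front/two-door model). -/
def thBDFDTD (p : C → A → Z → Y → ℝ) (yv : Y → ℝ) (astar acirc : A) : ℝ :=
  ∑ c, ∑ z, EYzc p yv z c * (cZA p z astar - cZA p z acirc) * pC p c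

/-- The efficient influence function φ_bdfdtd. -/
def phiBDFDTD [DecidableEq A] (p : C → A → Z → Y → ℝ) (yv : Y → ℝ) (astar acirc : A)
    (c : C) (a : A) (z : Z) (y : Y) : ℝ :=
  (yv y - EYzc p yv z c) * (cZA p z astar - cZA p z acirc) / (∑ ab, cA p ab c * cZA p z ab)
  + (∑ c', (EYzc p yv z c' - ∑ z', EYzc p yv z' c' * cZA p z' a) * pC p c')
    * (ind a astar - ind a acirc) / (∑ c', pC p c' * cA p a c')
  + (∑ z', EYzc p yv z' c * (cZA p z' astar - cZA p z' acirc))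
  - thBDFDTD p yv astar acirc


theorem pCAZ_pos {C A Z Y : Type*} [Fintype Y]
    [Nonempty Y] {p : C → A → Z → Y → ℝ} (hp : ∀ c a z y, 0 < p c a z y)
    (c : C) (a : A) (z : Z) : 0 < pCAZ p c a z :=
  sum_pos (fun y _ => hp c a z y) univ_nonempty

theorem pAC_pos {C A Z Y : Type*} [Fintype Z] [Fintype Y]
    [Nonempty Z] [Nonempty Y] {p : C → A → Z → Y → ℝ}
    (hp : ∀ c a z y, 0 < p c a z y) (a : A) (c : C) : 0 < pAC p a c :=
  sum_pos (fun z _ => pCAZ_pos hp c a z) univ_nonempty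

theorem pC_pos {C A Z Y : Type*} [Fintype A] [Fintype Z] [Fintype Y]
    [Nonempty A] [Nonempty Z] [Nonempty Y] {p : C → A → Z → Y → ℝ}
    (hp : ∀ c a z y, 0 < p c a z y) (c : C) : 0 < pC p c :=
  sum_pos (fun a _ => pAC_pos hp a c) univ_nonempty

theorem sum_mul_eq_pCAZ_mul_EYazc {C A Z Y : Type*} [Fintype Y]
    {p : C → A → Z → Y → ℝ} (yv : Y → ℝ) {c : C} {a : A} {z : Z}
    (h : pCAZ p c a z ≠ 0) : ∑ y, p c a z y * yv y = pCAZ p c a z * EYazc p yv a z c := by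
  rw [EYazc, mul_sum]
  refine sum_congr rfl fun y _ => ?_
  rw [cY]
  field_simp

theorem sum_mul_sq_eq_pCAZ_mul {C A Z Y : Type*} [Fintype Y]
    {p : C → A → Z → Y → ℝ} (yv : Y → ℝ) {c : C} {a : A} {z : Z}
    (h : pCAZ p c a z ≠ 0) :
    ∑ y, p c a z y * yv y ^ 2 = pCAZ p c a z * (VYazc p yv a z c + EYazc p yv a z c ^ 2) := by
  rw [VYazc, sub_add_cancel, mul_sum]
  refine sum_congr rfl fun y _ => ?_
  rw [cY]
  field_simp

/-- Mean over the outcome of an affine function of the outcome residual. -/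
theorem sum_mul_residual_add {C A Z Y : Type*} [Fintype Y]
    {p : C → A → Z → Y → ℝ} (yv : Y → ℝ) {c : C} {a : A} {z : Z}
    (h : pCAZ p c a z ≠ 0) (k m : ℝ) :
    ∑ y, p c a z y * ((yv y - EYazc p yv a z c) * k + m) = pCAZ p c a z * m := by
  have h1 := sum_mul_eq_pCAZ_mul_EYazc yv h
  have h0 : ∑ y, p c a z y = pCAZ p c a z := rfl
  calc _ = k * ∑ y, p c a z y * yv y + (m - k * EYazc p yv a z c) * ∑ y, p c a z y := by
        rw [mul_sum, mul_sum, ← sum_add_distrib]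
        exact sum_congr rfl fun y _ => by ring
    _ = _ := by rw [h1, h0]; ring

/-- Second moment over the outcome of an affine function of the outcome residual. -/
theorem sum_mul_residual_add_sq {C A Z Y : Type*} [Fintype Y]
    {p : C → A → Z → Y → ℝ} (yv : Y → ℝ) {c : C} {a : A} {z : Z}
    (h : pCAZ p c a z ≠ 0) (k m : ℝ) :
    ∑ y, p c a z y * ((yv y - EYazc p yv a z c) * k + m) ^ 2
      = pCAZ p c a z * (k ^ 2 * VYazc p yv a z c + m ^ 2) := by
  have h1 := sum_mul_eq_pCAZ_mul_EYazc yv h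
  have h2 := sum_mul_sq_eq_pCAZ_mul yv h
  have h0 : ∑ y, p c a z y = pCAZ p c a z := rfl
  calc _ = k ^ 2 * ∑ y, p c a z y * yv y ^ 2
          + 2 * k * (m - k * EYazc p yv a z c) * ∑ y, p c a z y * yv y
          + (m - k * EYazc p yv a z c) ^ 2 * ∑ y, p c a z y := by
        rw [mul_sum, mul_sum, mul_sum, ← sum_add_distrib, ← sum_add_distrib]
        exact sum_congr rfl fun y _ => by ring
    _ = _ := by rw [h1, h2, h0]; ring

/-- Mean of an affine function of the deviation of `G` from its weighted mean `μ`. -/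
theorem sum_mul_deviation_add {Z : Type*} [Fintype Z] {q G : Z → ℝ} {P μ : ℝ}
    (hP : ∑ z, q z = P) (hμ : ∑ z, q z * G z = P * μ) (w r : ℝ) :
    ∑ z, q z * ((G z - μ) * w + r) = P * r := by
  calc _ = w * ∑ z, q z * G z + (r - w * μ) * ∑ z, q z := by
        rw [mul_sum, mul_sum, ← sum_add_distrib]
        exact sum_congr rfl fun z _ => by ring
    _ = _ := by rw [hμ, hP]; ring

/-- Second moment of an affine function of the deviation of `G` from its weighted mean `μ`. -/
theorem sum_mul_deviation_add_sq {Z : Type*} [Fintype Z] {q G : Z → ℝ} {P μ : ℝ}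
    (hP : ∑ z, q z = P) (hμ : ∑ z, q z * G z = P * μ) (w r : ℝ) :
    ∑ z, q z * ((G z - μ) * w + r) ^ 2
      = w ^ 2 * (∑ z, q z * G z ^ 2 - P * μ ^ 2) + P * r ^ 2 := by
  calc _ = w ^ 2 * ∑ z, q z * G z ^ 2 + 2 * w * (r - w * μ) * ∑ z, q z * G z
          + (r - w * μ) ^ 2 * ∑ z, q z := by
        rw [mul_sum, mul_sum, mul_sum, ← sum_add_distrib, ← sum_add_distrib]
        exact sum_congr rfl fun z _ => by ring
    _ = _ := by rw [hμ, hP]; ring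

theorem sum_ind_sub_ind_sq_mul {A : Type*} [Fintype A] [DecidableEq A] {s t : A} (h : s ≠ t)
    (X : A → ℝ) : ∑ a, (ind a s - ind a t) ^ 2 * X a = X s + X t := by
  have key : ∀ a, (ind a s - ind a t) ^ 2 * X a
      = (if a = s then X a else 0) + (if a = t then X a else 0) := by
    intro a
    unfold ind
    by_cases hs : a = s
    · have ht : a ≠ t := fun e => h (hs.symm.trans e)
      simp [hs, h]
    · by_cases ht : a = t
      · simp [ht, h.symm]
      · simp [hs, ht]
  simp [key, sum_add_distrib]

/-- Proposition 1 (semiparametric efficiency bound under the two-door assumption). -/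
theorem stmt0
    {C A Z Y : Type*} [Fintype C] [Fintype A] [Fintype Z] [Fintype Y]
    [Nonempty C] [Nonempty A] [Nonempty Z] [Nonempty Y] [DecidableEq A]
    (p : C → A → Z → Y → ℝ) (yv : Y → ℝ) (hyv : Function.Injective yv)
    (hp : IsPMF p) (astar acirc : A) (hne : astar ≠ acirc) :
    Varp p (phiTD p yv astar acirc) =
      (∑ z, ∑ c, (cZ p z astar c - cZ p z acirc c) ^ 2
          * ∑ ab, pAC p ab c * VYazc p yv ab z c / cZ p z ab c)
      + (∑ z, ∑ c, cZ p z astar c * (∑ ab, EYazc p yv ab z c * cA p ab c) ^ 2 * pC p c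
            / cA p astar c)
      + (∑ z, ∑ c, cZ p z acirc c * (∑ ab, EYazc p yv ab z c * cA p ab c) ^ 2 * pC p c
            / cA p acirc c)
      - (∑ c, ((∑ ab, ∑ z, EYazc p yv ab z c * cZ p z astar c * cA p ab c) ^ 2 / cA p astar c
              + (∑ ab, ∑ z, EYazc p yv ab z c * cZ p z acirc c * cA p ab c) ^ 2 / cA p acirc c)
            * pC p c)
      + (∑ ab, ∑ c, (∑ z, EYazc p yv ab z c * (cZ p z astar c - cZ p z acirc c)) ^ 2
            * pAC p ab c)
      - (thTD p yv astar acirc) ^ 2 := by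
  obtain ⟨hpos, hsum⟩ := hp
  set θ := thTD p yv astar acirc with hθ
  set M : Z → C → ℝ := fun z c => ∑ ab, EYazc p yv ab z c * cA p ab c with hM
  set μ : A → C → ℝ := fun a c => ∑ ab, ∑ z, EYazc p yv ab z c * cZ p z a c * cA p ab c with hμ
  set Δ : Z → C → ℝ := fun z c => cZ p z astar c - cZ p z acirc c with hΔ
  set h : A → C → ℝ := fun a c => ∑ z, EYazc p yv a z c * Δ z c with hh
  have nCAZ := fun c a z => (pCAZ_pos hpos c a z).ne'
  have nAC := fun a c => (pAC_pos hpos a c).ne'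
  have nC := fun c => (pC_pos hpos c).ne'
  have mass : ∀ a c, ∑ z, pCAZ p c a z = pAC p a c := fun _ _ => rfl
  have mean : ∀ a c, ∑ z, pCAZ p c a z * M z c = pAC p a c * μ a c := by
    intro a c
    simp only [hM, hμ]
    rw [sum_comm, mul_sum]
    refine sum_congr rfl fun z _ => ?_
    rw [mul_sum, mul_sum]
    refine sum_congr rfl fun ab _ => ?_
    have := nAC a c
    rw [cZ]
    field_simp
  have phi_eq : ∀ c a z y, phiTD p yv astar acirc c a z y
      = (yv y - EYazc p yv a z c) * (Δ z c / cZ p z a c)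
        + ((M z c - μ a c) * ((ind a astar - ind a acirc) / cA p a c) + (h a c - θ)) := by
    intro c a z y
    simp only [phiTD, hM, hμ, hΔ, hh, hθ]
    ring
  have total : ∑ c, ∑ a, pAC p a c = 1 := hsum
  have theta_eq : ∑ c, ∑ a, pAC p a c * h a c = θ := by
    rw [hθ, thTD, sum_comm]
    simp only [hh, mul_sum]
    refine Eq.trans ?_ sum_comm
    rw [sum_comm]
    refine sum_congr rfl fun c _ => ?_
    rw [sum_comm]
    refine sum_congr rfl fun z _ => sum_congr rfl fun a _ => ?_
    have := nC c
    rw [cA]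
    field_simp
    rfl
  have mean_zero : Ep p (phiTD p yv astar acirc) = 0 := by
    simp only [Ep, phi_eq, sum_mul_residual_add yv (nCAZ _ _ _),
      sum_mul_deviation_add (mass _ _) (mean _ _), mul_sub, sum_sub_distrib, ← sum_mul]
    rw [theta_eq, total]
    ring
  have centered : ∑ c, ∑ a, pAC p a c * (h a c - θ) ^ 2
      = (∑ a, ∑ c, h a c ^ 2 * pAC p a c) - θ ^ 2 := by
    calc _ = (∑ c, ∑ a, h a c ^ 2 * pAC p a c) - 2 * θ * (∑ c, ∑ a, pAC p a c * h a c)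
          + θ ^ 2 * ∑ c, ∑ a, pAC p a c := by
          simp only [mul_sum, ← sum_add_distrib, ← sum_sub_distrib]
          exact sum_congr rfl fun c _ => sum_congr rfl fun a _ => by ring
      _ = _ := by rw [theta_eq, total, sum_comm]; ring
  have residual : ∑ c, ∑ a, ∑ z, pCAZ p c a z * ((Δ z c / cZ p z a c) ^ 2 * VYazc p yv a z c)
      = ∑ z, ∑ c, Δ z c ^ 2 * ∑ ab, pAC p ab c * VYazc p yv ab z c / cZ p z ab c := by
    refine Eq.trans ?_ sum_comm
    refine sum_congr rfl fun c _ => ?_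
    rw [sum_comm]
    refine sum_congr rfl fun z _ => ?_
    rw [mul_sum]
    refine sum_congr rfl fun a _ => ?_
    have := nAC a c
    have := nCAZ c a z
    rw [cZ]
    field_simp
  have arm : ∀ a c, (1 / cA p a c) ^ 2 * (∑ z, pCAZ p c a z * M z c ^ 2 - pAC p a c * μ a c ^ 2)
      = ∑ z, cZ p z a c * M z c ^ 2 * pC p c / cA p a c - μ a c ^ 2 / cA p a c * pC p c := by
    intro a c
    have := nAC a c
    have := nC c
    rw [mul_sub, mul_sum]
    congr 1
    · refine sum_congr rfl fun z _ => ?_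
      rw [cZ, cA]
      field_simp
    · rw [cA]
      field_simp
  have mediator : ∑ c, ∑ a, ((ind a astar - ind a acirc) / cA p a c) ^ 2
        * (∑ z, pCAZ p c a z * M z c ^ 2 - pAC p a c * μ a c ^ 2)
      = (∑ z, ∑ c, cZ p z astar c * M z c ^ 2 * pC p c / cA p astar c)
        + (∑ z, ∑ c, cZ p z acirc c * M z c ^ 2 * pC p c / cA p acirc c)
        - ∑ c, (μ astar c ^ 2 / cA p astar c + μ acirc c ^ 2 / cA p acirc c) * pC p c := by
    rw [sum_comm (s := (univ : Finset Z)) (t := (univ : Finset C)),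
      sum_comm (s := (univ : Finset Z)) (t := (univ : Finset C)),
      ← sum_add_distrib, ← sum_sub_distrib]
    refine sum_congr rfl fun c _ => ?_
    simp only [div_eq_mul_one_div (ind _ _ - ind _ _) (cA p _ c), mul_pow, mul_assoc]
    rw [sum_ind_sub_ind_sq_mul hne]
    have h1 := arm astar c
    have h2 := arm acirc c
    simp only [mul_assoc] at h1 h2
    rw [h1, h2]
    ring
  calc Varp p (phiTD p yv astar acirc)
      = (∑ c, ∑ a, ∑ z, pCAZ p c a z * ((Δ z c / cZ p z a c) ^ 2 * VYazc p yv a z c))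
        + (∑ c, ∑ a, ((ind a astar - ind a acirc) / cA p a c) ^ 2
          * (∑ z, pCAZ p c a z * M z c ^ 2 - pAC p a c * μ a c ^ 2))
        + ∑ c, ∑ a, pAC p a c * (h a c - θ) ^ 2 := by
        rw [Varp, mean_zero]
        simp only [phi_eq, sum_mul_residual_add_sq yv (nCAZ _ _ _), mul_add (pCAZ p _ _ _),
          sum_add_distrib, sum_mul_deviation_add_sq (mass _ _) (mean _ _)]
        ring
    _ = _ := by
        rw [residual, mediator, centered]
        ring

end TwoDoorPaper
end
end

section
/- Let π be a real number with 0 < π < 1 and set u = π·(1 − π). For every real r > 0: r + 1/r − 2 − 1/u ≤ 0 if and only if (2u + 1 − √(4u + 1))/(2u) ≤ r ≤ (2u + 1 + √(4u + 1))/(2u). -/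
/-- Completing the square: for `u, r > 0`, the sign of `r + 1 / r - 2 - 1 / u` is governed by
a quadratic in `r` of discriminant `4 * u + 1`. -/
theorem add_one_div_sub_nonpos_iff_sq_le {u r : ℝ} (hu : 0 < u) (hr : 0 < r) :
    r + 1 / r - 2 - 1 / u ≤ 0 ↔ (2 * u * r - (2 * u + 1)) ^ 2 ≤ 4 * u + 1 := by
  have key : (2 * u * r - (2 * u + 1)) ^ 2 - (4 * u + 1) =
      4 * u ^ 2 * r * (r + 1 / r - 2 - 1 / u) := by
    field_simp
    ring
  have hpos : 0 < 4 * u ^ 2 * r := by positivity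
  rw [← sub_nonpos (b := 4 * u + 1), key, mul_nonpos_iff_pos_imp_nonpos]
  exact ⟨fun h => ⟨fun _ => h, fun _ => hpos.le⟩, fun h => h.1 hpos⟩

/-- The interval I_{td ≤ bd} characterizing when the two-door bound is at most the
back-door bound, in the binary-treatment case. -/
theorem stmt4 (π : ℝ) (hπ₀ : 0 < π) (hπ₁ : π < 1) (r : ℝ) (hr : 0 < r) :
    r + 1 / r - 2 - 1 / (π * (1 - π)) ≤ 0 ↔
      (2 * (π * (1 - π)) + 1 - Real.sqrt (4 * (π * (1 - π)) + 1)) / (2 * (π * (1 - π))) ≤ r ∧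
        r ≤ (2 * (π * (1 - π)) + 1 + Real.sqrt (4 * (π * (1 - π)) + 1)) / (2 * (π * (1 - π))) := by
  have hu : 0 < π * (1 - π) := mul_pos hπ₀ (sub_pos.2 hπ₁)
  generalize π * (1 - π) = u at hu ⊢
  rw [add_one_div_sub_nonpos_iff_sq_le hu hr, Real.sq_le (by positivity),
    div_le_iff₀ (by positivity), le_div_iff₀ (by positivity)]
  constructor <;> rintro ⟨h₁, h₂⟩ <;> constructor <;> linarith
end

section
/- Let I be a finite nonempty type, let w : I → ℝ satisfy w(i) > 0 for all i and Σ_i w(i) = 1, and let q : I → ℝ satisfy q(i) > 0 for all i. Then for all i₁, i₂ ∈ I: (q(i₁) − q(i₂))² < (Σ_i w(i)·q(i))·(q(i₁)/w(i₁) + q(i₂)/w(i₂)). -/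
open Finset

theorem sq_sub_lt_weighted_pair {a b x y : ℝ} (ha : 0 < a) (hb : 0 < b) (hx : 0 < x)
    (hy : 0 < y) : (x - y) ^ 2 < (a * x + b * y) * (x / a + y / b) := by
  have expand : (a * x + b * y) * (x / a + y / b) =
      x ^ 2 + y ^ 2 + x * y * (a / b + b / a) := by
    field_simp
    ring
  have cross : 0 < x * y * (a / b + b / a) := by positivity
  rw [expand]
  nlinarith [mul_pos hx hy]

/-- Finite weighted inequality: the pointwise step showing that the combined
back-door/two-door bound is strictly below the back-door bound termwise. -/
theorem stmt8 {I : Type*} [Fintype I] [Nonempty I]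
    (w q : I → ℝ) (hw : ∀ i, 0 < w i) (hw1 : (∑ i, w i) = 1) (hq : ∀ i, 0 < q i) :
    ∀ i₁ i₂ : I, (q i₁ - q i₂) ^ 2 < (∑ i, w i * q i) * (q i₁ / w i₁ + q i₂ / w i₂) := by
  classical
  intro i j
  have hpos : 0 < q i / w i + q j / w j :=
    add_pos (div_pos (hq i) (hw i)) (div_pos (hq j) (hw j))
  by_cases hij : i = j
  · have hsum : 0 < ∑ k, w k * q k :=
      sum_pos (fun k _ => mul_pos (hw k) (hq k)) univ_nonempty
    rw [hij, sub_self, zero_pow two_ne_zero]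
    exact mul_pos hsum (hij ▸ hpos)
  · have hpair : w i * q i + w j * q j ≤ ∑ k, w k * q k := by
      rw [← sum_pair (f := fun k => w k * q k) hij]
      exact sum_le_sum_of_subset_of_nonneg (subset_univ _)
        fun k _ _ => (mul_pos (hw k) (hq k)).le
    exact (sq_sub_lt_weighted_pair (hw i) (hw j) (hq i) (hq j)).trans_le
      (mul_le_mul_of_nonneg_right hpair hpos.le)
end

section
/- Let ψ_fd, θ_fd and φ_fd be as defined in the context. Then Var_p(φ_fd) = Σ_z (p(z|a⋆) − p(z|a°))²·Σ_ā p(ā)·var(Y|ā,z)/p(z|ā) + Σ_z (Σ_ā E(Y|ā,z)·p(ā))²·(p(z|a⋆)/p(a⋆) + p(z|a°)/p(a°)) − ψ_fd(a⋆)²/p(a⋆) − ψ_fd(a°)²/p(a°) + Σ_ā p(ā)·(Σ_z E(Y|ā,z)·(p(z|a⋆) − p(z|a°)))² − θ_fd². -/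
open Finset

noncomputable section

namespace TwoDoorPaper

variable {C A Z Y : Type*} [Fintype C] [Fintype A] [Fintype Z] [Fintype Y]

theorem sum_law_mul_eq_sum_marginal_mul (p : C → A → Z → Y → ℝ) (F : A → Z → Y → ℝ) :
    ∑ c, ∑ a, ∑ z, ∑ y, p c a z y * F a z y = ∑ a, ∑ z, ∑ y, (∑ c, p c a z y) * F a z y := by
  rw [sum_comm]
  refine sum_congr rfl fun a _ => ?_
  rw [sum_comm]
  refine sum_congr rfl fun z _ => ?_
  rw [sum_comm]
  exact sum_congr rfl fun y _ => (sum_mul _ _ _).symm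

theorem sum_marginal_eq_pAZ (p : C → A → Z → Y → ℝ) (a : A) (z : Z) :
    ∑ y, ∑ c, p c a z y = pAZ p a z := by
  rw [sum_comm]; rfl

theorem sum_pAZ_eq_pA (p : C → A → Z → Y → ℝ) (a : A) : ∑ z, pAZ p a z = pA p a := by
  simp only [pAZ, pA, pAC, pCAZ]
  exact sum_comm

theorem IsPMF.pAZ_pos [Nonempty C] [Nonempty Y] {p : C → A → Z → Y → ℝ} (hp : IsPMF p)
    (a : A) (z : Z) : 0 < pAZ p a z :=
  sum_pos (fun c _ => sum_pos (fun y _ => hp.1 c a z y) univ_nonempty) univ_nonempty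

theorem IsPMF.pA_pos [Nonempty C] [Nonempty Z] [Nonempty Y] {p : C → A → Z → Y → ℝ}
    (hp : IsPMF p) (a : A) : 0 < pA p a := by
  rw [← sum_pAZ_eq_pA]
  exact sum_pos (fun z _ => hp.pAZ_pos a z) univ_nonempty

theorem IsPMF.sum_pA {p : C → A → Z → Y → ℝ} (hp : IsPMF p) : ∑ a, pA p a = 1 := by
  rw [← hp.2]
  simp only [pA, pAC]
  exact sum_comm

/-- First conditional moment, given `(a, z)`, of an affine function of the centred outcome. -/
theorem sum_marginal_mul_affine (p : C → A → Z → Y → ℝ) (yv : Y → ℝ) (a : A) (z : Z)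
    (h : pAZ p a z ≠ 0) (k g : ℝ) :
    ∑ y, (∑ c, p c a z y) * (k * (yv y - EYaz p yv a z) + g) = pAZ p a z * g := by
  have h1 : ∑ y, (∑ c, p c a z y) * yv y = pAZ p a z * EYaz p yv a z := by
    simp only [EYaz, cYaz, mul_sum]
    exact sum_congr rfl fun y _ => by field_simp
  have h0 := sum_marginal_eq_pAZ p a z
  calc _ = k * ∑ y, (∑ c, p c a z y) * yv y
        + (g - k * EYaz p yv a z) * ∑ y, ∑ c, p c a z y := by
        rw [mul_sum, mul_sum, ← sum_add_distrib]
        exact sum_congr rfl fun y _ => by ring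
    _ = _ := by rw [h1, h0]; ring

/-- Second conditional moment, given `(a, z)`, of an affine function of the centred outcome. -/
theorem sum_marginal_mul_affine_sq (p : C → A → Z → Y → ℝ) (yv : Y → ℝ) (a : A) (z : Z)
    (h : pAZ p a z ≠ 0) (k g : ℝ) :
    ∑ y, (∑ c, p c a z y) * (k * (yv y - EYaz p yv a z) + g) ^ 2
      = pAZ p a z * (k ^ 2 * VYaz p yv a z + g ^ 2) := by
  have h1 : ∑ y, (∑ c, p c a z y) * yv y = pAZ p a z * EYaz p yv a z := by
    simp only [EYaz, cYaz, mul_sum]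
    exact sum_congr rfl fun y _ => by field_simp
  have h2 : ∑ y, (∑ c, p c a z y) * yv y ^ 2
      = pAZ p a z * (VYaz p yv a z + EYaz p yv a z ^ 2) := by
    simp only [VYaz, sub_add_cancel, cYaz, mul_sum]
    exact sum_congr rfl fun y _ => by field_simp
  have h0 := sum_marginal_eq_pAZ p a z
  calc _ = k ^ 2 * ∑ y, (∑ c, p c a z y) * yv y ^ 2
        + 2 * k * (g - k * EYaz p yv a z) * ∑ y, (∑ c, p c a z y) * yv y
        + (g - k * EYaz p yv a z) ^ 2 * ∑ y, ∑ c, p c a z y := by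
        rw [mul_sum, mul_sum, mul_sum, ← sum_add_distrib, ← sum_add_distrib]
        exact sum_congr rfl fun y _ => by ring
    _ = _ := by rw [h1, h2, h0]; ring

theorem sum_mul_affine {r : Z → ℝ} (hr : ∑ z, r z = 1) (m : Z → ℝ) (s t : ℝ) :
    ∑ z, r z * (s * (m z - ∑ z', r z' * m z') + t) = t := by
  obtain ⟨μ, hμ⟩ : ∃ μ, ∑ z', r z' * m z' = μ := ⟨_, rfl⟩
  simp only [hμ]
  calc _ = s * ∑ z, r z * m z + (t - s * μ) * ∑ z, r z := by
        rw [mul_sum, mul_sum, ← sum_add_distrib]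
        exact sum_congr rfl fun z _ => by ring
    _ = t := by rw [hr, hμ]; ring

theorem sum_mul_affine_sq {r : Z → ℝ} (hr : ∑ z, r z = 1) (m : Z → ℝ) (s t : ℝ) :
    ∑ z, r z * (s * (m z - ∑ z', r z' * m z') + t) ^ 2
      = s ^ 2 * (∑ z, r z * m z ^ 2 - (∑ z, r z * m z) ^ 2) + t ^ 2 := by
  obtain ⟨μ, hμ⟩ : ∃ μ, ∑ z', r z' * m z' = μ := ⟨_, rfl⟩
  simp only [hμ]
  calc _ = s ^ 2 * ∑ z, r z * m z ^ 2 + 2 * s * (t - s * μ) * ∑ z, r z * m z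
        + (t - s * μ) ^ 2 * ∑ z, r z := by
        rw [mul_sum, mul_sum, mul_sum, ← sum_add_distrib, ← sum_add_distrib]
        exact sum_congr rfl fun z _ => by ring
    _ = _ := by rw [hr, hμ]; ring

theorem psiFD_eq_sum_cZA_mul (p : C → A → Z → Y → ℝ) (yv : Y → ℝ) (a : A) :
    psiFD p yv a = ∑ z, cZA p z a * ∑ ab, EYaz p yv ab z * pA p ab := by
  refine sum_congr rfl fun z _ => ?_
  rw [← sum_mul, mul_comm]

theorem sum_pA_mul_eq_thFD (p : C → A → Z → Y → ℝ) (yv : Y → ℝ) (astar acirc : A) :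
    ∑ a, pA p a * ∑ z, EYaz p yv a z * (cZA p z astar - cZA p z acirc)
      = thFD p yv astar acirc := by
  simp only [thFD, psiFD, ← sum_sub_distrib, mul_sum]
  rw [sum_comm]
  exact sum_congr rfl fun z _ => sum_congr rfl fun a _ => by ring

/-- The front-door influence function as the sum of its outcome, mediator and treatment scores. -/
theorem phiFD_eq_affine [DecidableEq A] (p : C → A → Z → Y → ℝ) (yv : Y → ℝ)
    (astar acirc : A) (c : C) (a : A) (z : Z) (y : Y) :
    phiFD p yv astar acirc c a z y =
      (cZA p z astar - cZA p z acirc) / cZA p z a * (yv y - EYaz p yv a z)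
      + ((ind a astar - ind a acirc) / pA p a
          * ((∑ ab, EYaz p yv ab z * pA p ab)
              - ∑ z', cZA p z' a * ∑ ab, EYaz p yv ab z' * pA p ab)
        + ((∑ z', EYaz p yv a z' * (cZA p z' astar - cZA p z' acirc))
            - thFD p yv astar acirc)) := by
  rw [← psiFD_eq_sum_cZA_mul]
  have h : ∀ b m, ind a b * (m - psiFD p yv b) / pA p b
      = ind a b / pA p a * (m - psiFD p yv a) := by
    intro b m
    by_cases hab : a = b
    · subst hab; ring
    · simp [ind, hab]
  rw [phiFD, h, h]
  ring

theorem sum_pA_mul_contrast_sq [DecidableEq A] {p : C → A → Z → Y → ℝ} {astar acirc : A}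
    (hne : astar ≠ acirc) (h : ∀ a, pA p a ≠ 0) (X : A → ℝ) :
    ∑ a, pA p a * (((ind a astar - ind a acirc) / pA p a) ^ 2 * X a)
      = X astar / pA p astar + X acirc / pA p acirc := by
  have key : ∀ a, pA p a * (((ind a astar - ind a acirc) / pA p a) ^ 2 * X a)
      = (if a = astar then X a / pA p a else 0) + (if a = acirc then X a / pA p a else 0) := by
    intro a
    have := h a
    by_cases h1 : a = astar
    · have h2 : a ≠ acirc := h1 ▸ hne
      simp only [ind, if_pos h1, if_neg h2]
      field_simp
      ring
    · by_cases h2 : a = acirc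
      · simp only [ind, if_neg h1, if_pos h2]
        field_simp
        ring
      · simp [ind, h1, h2]
  simp [key, sum_add_distrib]

/-- Proposition 4 (semiparametric efficiency bound under the front-door assumption). -/
theorem stmt9
    {C A Z Y : Type*} [Fintype C] [Fintype A] [Fintype Z] [Fintype Y]
    [Nonempty C] [Nonempty A] [Nonempty Z] [Nonempty Y] [DecidableEq A]
    (p : C → A → Z → Y → ℝ) (yv : Y → ℝ) (hyv : Function.Injective yv)
    (hp : IsPMF p) (astar acirc : A) (hne : astar ≠ acirc) :
    Varp p (phiFD p yv astar acirc) =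
      (∑ z, (cZA p z astar - cZA p z acirc) ^ 2
          * ∑ ab, pA p ab * VYaz p yv ab z / cZA p z ab)
      + (∑ z, (∑ ab, EYaz p yv ab z * pA p ab) ^ 2
            * (cZA p z astar / pA p astar + cZA p z acirc / pA p acirc))
      - (psiFD p yv astar) ^ 2 / pA p astar
      - (psiFD p yv acirc) ^ 2 / pA p acirc
      + (∑ ab, pA p ab * (∑ z, EYaz p yv ab z * (cZA p z astar - cZA p z acirc)) ^ 2)
      - (thFD p yv astar acirc) ^ 2 := by
  have hAZ := fun a z => (hp.pAZ_pos a z).ne'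
  have hA := fun a => (hp.pA_pos a).ne'
  have hr : ∀ a, ∑ z, cZA p z a = 1 := fun a => by
    simp only [cZA, ← sum_div, sum_pAZ_eq_pA]
    exact div_self (hA a)
  have hw : ∀ a z, pAZ p a z = pA p a * cZA p z a := fun a z => by
    rw [cZA, mul_div_cancel₀ _ (hA a)]
  have hr0 : ∀ a z, cZA p z a ≠ 0 := fun a z => div_ne_zero (hAZ a z) (hA a)
  have hθ := sum_pA_mul_eq_thFD p yv astar acirc
  have hmean : Ep p (phiFD p yv astar acirc) = 0 := by
    simp only [Ep, phiFD_eq_affine]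
    rw [sum_law_mul_eq_sum_marginal_mul p]
    simp only [sum_marginal_mul_affine p yv _ _ (hAZ _ _), hw, mul_assoc, ← mul_sum]
    simp only [sum_mul_affine (hr _)]
    simp only [mul_sub (pA p _), sum_sub_distrib, hθ, ← sum_mul, hp.sum_pA]
    ring
  have houtcome : ∑ a, ∑ z, pA p a * (cZA p z a
        * (((cZA p z astar - cZA p z acirc) / cZA p z a) ^ 2 * VYaz p yv a z))
      = ∑ z, (cZA p z astar - cZA p z acirc) ^ 2
          * ∑ ab, pA p ab * VYaz p yv ab z / cZA p z ab := by
    rw [sum_comm]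
    refine sum_congr rfl fun z _ => ?_
    rw [mul_sum]
    refine sum_congr rfl fun a _ => ?_
    have := hr0 a z
    field_simp
  have htreat : ∑ a, pA p a * ((∑ z, EYaz p yv a z * (cZA p z astar - cZA p z acirc))
        - thFD p yv astar acirc) ^ 2
      = (∑ a, pA p a * (∑ z, EYaz p yv a z * (cZA p z astar - cZA p z acirc)) ^ 2)
        - thFD p yv astar acirc ^ 2 := by
    have hexp : ∀ a, pA p a * ((∑ z, EYaz p yv a z * (cZA p z astar - cZA p z acirc))
          - thFD p yv astar acirc) ^ 2
        = pA p a * (∑ z, EYaz p yv a z * (cZA p z astar - cZA p z acirc)) ^ 2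
          - (pA p a * ∑ z, EYaz p yv a z * (cZA p z astar - cZA p z acirc))
            * (2 * thFD p yv astar acirc)
          + pA p a * thFD p yv astar acirc ^ 2 := fun a => by ring
    simp only [hexp, sum_add_distrib, sum_sub_distrib, ← sum_mul, hθ, hp.sum_pA]
    ring
  have hmed : (∑ z, (∑ ab, EYaz p yv ab z * pA p ab) ^ 2
        * (cZA p z astar / pA p astar + cZA p z acirc / pA p acirc))
      = (∑ z, cZA p z astar * (∑ ab, EYaz p yv ab z * pA p ab) ^ 2) / pA p astar
        + (∑ z, cZA p z acirc * (∑ ab, EYaz p yv ab z * pA p ab) ^ 2) / pA p acirc := by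
    rw [sum_div, sum_div, ← sum_add_distrib]
    exact sum_congr rfl fun z _ => by ring
  rw [Varp, hmean]
  simp only [phiFD_eq_affine]
  rw [sum_law_mul_eq_sum_marginal_mul p]
  simp only [sum_marginal_mul_affine_sq p yv _ _ (hAZ _ _), hw, mul_assoc]
  simp only [mul_add (cZA p _ _), mul_add (pA p _), sum_add_distrib]
  rw [houtcome]
  simp only [← mul_sum, sum_mul_affine_sq (hr _), mul_add (pA p _), sum_add_distrib]
  rw [htreat, sum_pA_mul_contrast_sq hne hA (fun a => ∑ z, cZA p z a
    * (∑ ab, EYaz p yv ab z * pA p ab) ^ 2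
    - (∑ z, cZA p z a * ∑ ab, EYaz p yv ab z * pA p ab) ^ 2), hmed]
  simp only [← psiFD_eq_sum_cZA_mul]
  ring

end TwoDoorPaper
end
end
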